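/- There exists a constant C > 0 such that for every finite directed graph G = (V,E) with n = |V| ≥ 2 vertices, there exists a set S of ordered pairs of vertices satisfying: (1) for every (u,v) ∈ S there is a directed path from u to v in G consisting of at most C·n^{2/3}·(log n)^{14} arcs (so in particular every element of S is a shortcut); (2) |S| ≤ C·n·(log n)⁴; and (3) for every pair of vertices u,v with u ⪯_G v, there is a directed path from u to v in the augmented graph (V, E ∪ S) consisting of at most C·n^{2/3}·(log n)^{4/3} arcs. -/

import Mathlib

/-- `ReachLen E k u v`: there is a directed path from `u` to `v` in the digraph with
arc relation `E` consisting of exactly `k` arcs. -/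
def ReachLen {V : Type*} (E : V → V → Prop) : ℕ → V → V → Prop
  | 0, u, v => u = v
  | n + 1, u, v => ∃ w, E u w ∧ ReachLen E n w v

/-- `Reaches E u v` (`u ⪯ v`): there is a (possibly empty) directed path from `u` to `v`. -/
def Reaches {V : Type*} (E : V → V → Prop) (u v : V) : Prop :=
  ∃ k, ReachLen E k u v

namespace ReachLen

variable {V : Type*} {E F : V → V → Prop}

theorem trans {i j : ℕ} {u v w : V} (h₁ : ReachLen E i u v) (h₂ : ReachLen E j v w) :
    ReachLen E (i + j) u w := by
  induction i generalizing u with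
  | zero => cases h₁; simpa using h₂
  | succ i ih =>
    obtain ⟨x, hx, h⟩ := h₁
    rw [Nat.succ_add]
    exact ⟨x, hx, ih h⟩

theorem split {i j : ℕ} {u w : V} (h : ReachLen E (i + j) u w) :
    ∃ v, ReachLen E i u v ∧ ReachLen E j v w := by
  induction i generalizing u with
  | zero => exact ⟨u, rfl, by simpa using h⟩
  | succ i ih =>
    rw [Nat.succ_add] at h
    obtain ⟨x, hx, h⟩ := h
    obtain ⟨v, h₁, h₂⟩ := ih h
    exact ⟨v, ⟨x, hx, h₁⟩, h₂⟩

theorem mono (hEF : ∀ a b, E a b → F a b) {k : ℕ} {u v : V} (h : ReachLen E k u v) :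
    ReachLen F k u v := by
  induction k generalizing u with
  | zero => exact h
  | succ k ih =>
    obtain ⟨x, hx, h⟩ := h
    exact ⟨x, hEF _ _ hx, ih h⟩

end ReachLen

/-- `IsDistance E k u v`: the distance from `u` to `v` is exactly `k`. -/
def IsDistance {V : Type*} (E : V → V → Prop) (k : ℕ) (u v : V) : Prop :=
  ReachLen E k u v ∧ ∀ j < k, ¬ ReachLen E j u v

open Classical in
/-- The vertices lying on a path with `k` arcs from `u` to `v`. -/
noncomputable def pathInterval {V : Type*} [Fintype V] (E : V → V → Prop) (k : ℕ) (u v : V) :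
    Finset V :=
  Finset.univ.filter fun a => ∃ i j, i + j = k ∧ ReachLen E i u a ∧ ReachLen E j a v

theorem IsDistance.lt_card_pathInterval {V : Type*} [Fintype V] {E : V → V → Prop} {k : ℕ}
    {u v : V} (h : IsDistance E k u v) : k < (pathInterval E k u v).card := by
  classical
  have hex : ∀ i : Fin (k + 1), ∃ w, ReachLen E i u w ∧ ReachLen E (k - i) w v := fun i =>
    ReachLen.split (by rw [Nat.add_sub_cancel' (Nat.lt_succ_iff.mp i.2)]; exact h.1)
  choose f hf₁ hf₂ using hex
  have hne : ∀ i j : Fin (k + 1), i < j → f i ≠ f j := by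
    intro i j hij heq
    have hi := hf₁ i
    rw [heq] at hi
    refine h.2 _ ?_ (hi.trans (hf₂ j))
    have hlt : (i : ℕ) < j := hij
    have := j.2
    omega
  have hinj : Function.Injective f := by
    intro i j heq
    rcases lt_trichotomy i j with hij | hij | hij
    · exact absurd heq (hne i j hij)
    · exact hij
    · exact absurd heq.symm (hne j i hij)
  have hcard : (Finset.univ.image f).card = k + 1 := by
    rw [Finset.card_image_of_injective _ hinj, Finset.card_univ, Fintype.card_fin]
  have hsub : Finset.univ.image f ⊆ pathInterval E k u v := by
    intro a ha
    obtain ⟨i, -, rfl⟩ := Finset.mem_image.mp ha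
    exact Finset.mem_filter.mpr ⟨Finset.mem_univ _, i, k - i,
      Nat.add_sub_cancel' (Nat.lt_succ_iff.mp i.2), hf₁ i, hf₂ i⟩
  have := Finset.card_le_card hsub
  omega

theorem Reaches.exists_isDistance {V : Type*} {E : V → V → Prop} {u v : V}
    (h : Reaches E u v) : ∃ k, IsDistance E k u v := by
  classical
  exact ⟨Nat.find h, Nat.find_spec h, fun _ hj => Nat.find_min h hj⟩

/-- Some vertex lies in at least a `t / n` fraction of a family of `t`-element subsets of an
`n`-element set. -/
theorem exists_mul_card_le_card_mul_card_filter_mem {V ι : Type*} [Fintype V] [Nonempty V]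
    [DecidableEq V] (P : Finset ι) (A : ι → Finset V) (t : ℕ) (hA : ∀ p ∈ P, t ≤ (A p).card) :
    ∃ v, t * P.card ≤ Fintype.card V * (P.filter fun p => v ∈ A p).card := by
  by_contra! hlt
  have h₁ : t * P.card ≤ ∑ v : V, (P.filter fun p => v ∈ A p).card := by
    calc t * P.card = ∑ _p ∈ P, t := by simp [mul_comm]
      _ ≤ ∑ p ∈ P, (A p).card := Finset.sum_le_sum hA
      _ = ∑ p ∈ P, ∑ v : V, if v ∈ A p then 1 else 0 := by simp
      _ = ∑ v : V, ∑ p ∈ P, if v ∈ A p then 1 else 0 := Finset.sum_comm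
      _ = ∑ v : V, (P.filter fun p => v ∈ A p).card := by simp
  have h₂ : ∑ v : V, Fintype.card V * (P.filter fun p => v ∈ A p).card <
      ∑ _v : V, t * P.card :=
    Finset.sum_lt_sum_of_nonempty Finset.univ_nonempty fun v _ => hlt v
  rw [← Finset.mul_sum, Finset.sum_const, Finset.card_univ, smul_eq_mul] at h₂
  exact absurd (Nat.mul_le_mul_left (Fintype.card V) h₁) (not_le.mpr h₂)

/-- Greedy hitting sets: `k` vertices suffice to miss at most an `exp (-t k / n)` fraction of a
family of `t`-element subsets of an `n`-element set. -/
theorem exists_card_le_card_filter_disjoint_le {V ι : Type*} [Fintype V] [Nonempty V]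
    [DecidableEq V] (P : Finset ι) (A : ι → Finset V) (t : ℕ) (hA : ∀ p ∈ P, t ≤ (A p).card)
    (k : ℕ) :
    ∃ R : Finset V, R.card ≤ k ∧ ((P.filter fun p => Disjoint (A p) R).card : ℝ) ≤
      P.card * Real.exp (-(t / Fintype.card V * k)) := by
  induction k with
  | zero => exact ⟨∅, by simp⟩
  | succ k ih =>
    obtain ⟨R, hR, hle⟩ := ih
    set Q := P.filter fun p => Disjoint (A p) R with hQ
    obtain ⟨v, hv⟩ := exists_mul_card_le_card_mul_card_filter_mem Q A t
      fun p hp => hA p (Finset.mem_of_mem_filter p hp)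
    refine ⟨insert v R, (Finset.card_insert_le _ _).trans (by omega), ?_⟩
    have hfilter : (P.filter fun p => Disjoint (A p) (insert v R)) =
        Q.filter fun p => v ∉ A p := by
      ext p
      simp only [hQ, Finset.mem_filter, Finset.disjoint_insert_right]
      tauto
    have hsplit := Finset.card_filter_add_card_filter_not (s := Q) fun p => v ∈ A p
    have hn : (0 : ℝ) < Fintype.card V := by exact_mod_cast Fintype.card_pos
    have hv' : (t : ℝ) * Q.card ≤ Fintype.card V * (Q.filter fun p => v ∈ A p).card := by
      exact_mod_cast hv
    have hsplit' : ((Q.filter fun p => v ∈ A p).card : ℝ) +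
        (Q.filter fun p => v ∉ A p).card = Q.card := by exact_mod_cast hsplit
    have hdiv : (t : ℝ) / Fintype.card V * Q.card ≤ (Q.filter fun p => v ∈ A p).card := by
      rw [div_mul_eq_mul_div, div_le_iff₀ hn]
      linarith
    have hexp := Real.add_one_le_exp (-((t : ℝ) / Fintype.card V))
    rw [hfilter]
    calc ((Q.filter fun p => v ∉ A p).card : ℝ)
        ≤ Q.card * (-(t / Fintype.card V) + 1) := by linarith
      _ ≤ Q.card * Real.exp (-(t / Fintype.card V)) := by gcongr
      _ ≤ P.card * Real.exp (-(t / Fintype.card V * k)) *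
          Real.exp (-(t / Fintype.card V)) := by gcongr
      _ = P.card * Real.exp (-(t / Fintype.card V * (k + 1 : ℕ))) := by
        rw [mul_assoc, ← Real.exp_add]
        push_cast
        ring_nf

/-- A set `R` hitting the path interval of every pair at distance `t`. -/
def HitsDistance {V : Type*} (E : V → V → Prop) (t : ℕ) (R : Finset V) : Prop :=
  ∀ x y, IsDistance E t x y →
    ∃ r ∈ R, ∃ i j, i + j = t ∧ ReachLen E i x r ∧ ReachLen E j r y

/-- If `t² ≥ n`, then `t ⌈3 log n⌉` vertices suffice to hit all pairs at distance `t`. -/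
theorem exists_hitsDistance {V : Type*} [Fintype V] (E : V → V → Prop) (t : ℕ)
    (hV : 2 ≤ Fintype.card V) (ht : Fintype.card V ≤ t * t) :
    ∃ R : Finset V, R.card ≤ t * ⌈3 * Real.log (Fintype.card V)⌉₊ ∧ HitsDistance E t R := by
  classical
  have : Nonempty V := Fintype.card_pos_iff.mp (by omega)
  set n := Fintype.card V with hn
  set L := ⌈3 * Real.log n⌉₊ with hL
  obtain ⟨R, hR, hle⟩ := exists_card_le_card_filter_disjoint_le
    (Finset.univ.filter fun p : V × V => IsDistance E t p.1 p.2)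
    (fun p => pathInterval E t p.1 p.2) t
    (fun p hp => ((Finset.mem_filter.mp hp).2.lt_card_pathInterval).le) (t * L)
  refine ⟨R, hR, ?_⟩
  have hn0 : (2 : ℝ) ≤ n := by exact_mod_cast hV
  have hnpos : (0 : ℝ) < n := by linarith
  have hP : ((Finset.univ.filter fun p : V × V => IsDistance E t p.1 p.2).card : ℝ) ≤
      (n : ℝ) ^ 2 := by
    have h := Finset.card_filter_le (Finset.univ : Finset (V × V))
      fun p => IsDistance E t p.1 p.2
    rw [Finset.card_univ, Fintype.card_prod, ← sq] at h
    exact_mod_cast h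
  have hexp : 3 * Real.log n ≤ t / n * ((t * L : ℕ) : ℝ) := by
    have ht' : (n : ℝ) ≤ t * t := by exact_mod_cast ht
    have h1 : (1 : ℝ) ≤ t * t / n := (one_le_div hnpos).mpr ht'
    calc 3 * Real.log n ≤ 1 * L := by rw [one_mul]; exact Nat.le_ceil _
      _ ≤ t * t / n * L := by gcongr
      _ = t / n * ((t * L : ℕ) : ℝ) := by push_cast; ring
  have hexp' : Real.exp (-(t / n * ((t * L : ℕ) : ℝ))) ≤ ((n : ℝ) ^ 3)⁻¹ := by
    calc Real.exp (-(t / n * ((t * L : ℕ) : ℝ))) ≤ Real.exp (-(3 * Real.log n)) :=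
          Real.exp_le_exp.mpr (by linarith)
      _ = ((n : ℝ) ^ 3)⁻¹ := by
        rw [Real.exp_neg, ← Real.exp_log (pow_pos hnpos 3), Real.log_pow]
        norm_num
  have hlt : (n : ℝ) ^ 2 * ((n : ℝ) ^ 3)⁻¹ < 1 := by
    rw [← div_eq_mul_inv, div_lt_one (pow_pos hnpos 3)]
    nlinarith [sq_nonneg (n : ℝ), pow_pos hnpos 2]
  intro x y hxy
  by_contra hno
  have hmem : (x, y) ∈ (Finset.univ.filter fun p : V × V => IsDistance E t p.1 p.2).filter
      fun p => Disjoint (pathInterval E t p.1 p.2) R := by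
    refine Finset.mem_filter.mpr ⟨Finset.mem_filter.mpr ⟨Finset.mem_univ _, hxy⟩, ?_⟩
    refine Finset.disjoint_left.mpr fun a ha haR => hno ⟨a, haR, ?_⟩
    exact (Finset.mem_filter.mp ha).2
  have hpos : (1 : ℝ) ≤ ((Finset.univ.filter fun p : V × V => IsDistance E t p.1 p.2).filter
      fun p => Disjoint (pathInterval E t p.1 p.2) R).card := by
    exact_mod_cast Finset.card_pos.mpr ⟨_, hmem⟩
  have : (1 : ℝ) ≤ (n : ℝ) ^ 2 * ((n : ℝ) ^ 3)⁻¹ :=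
    (hpos.trans hle).trans (mul_le_mul hP hexp' (Real.exp_pos _).le (by positivity))
  linarith

section Shortcuts

variable {V : Type*} {E F : V → V → Prop} {t : ℕ} {R : Finset V}

/-- From a hitting vertex, `ℓ` arcs of the original graph can be replaced by `ℓ / t + 2 t` arcs
of a graph containing all shortcuts of span at most `2 t` between hitting vertices. -/
theorem HitsDistance.exists_reachLen_of_mem (hR : HitsDistance E t R) (ht : 0 < t)
    (hEF : ∀ a b, E a b → F a b)
    (hF : ∀ a ∈ R, ∀ b ∈ R, ∀ k ≤ 2 * t, ReachLen E k a b → F a b)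
    (ℓ : ℕ) {r v : V} (hr : r ∈ R) (h : ReachLen E ℓ r v) :
    ∃ k ≤ ℓ / t + 2 * t, ReachLen F k r v := by
  induction ℓ using Nat.strong_induction_on generalizing r with
  | _ ℓ ih =>
    by_cases hℓ : ℓ < 2 * t
    · exact ⟨ℓ, hℓ.le.trans (Nat.le_add_left _ _), h.mono hEF⟩
    obtain ⟨m, rfl⟩ : ∃ m, ℓ = t + (t + m) := ⟨ℓ - 2 * t, by omega⟩
    obtain ⟨x, hrx, hxv⟩ := h.split
    obtain ⟨y, hxy, hyv⟩ := hxv.split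
    by_cases hmin : ∀ j < t, ¬ ReachLen E j x y
    · obtain ⟨s, hs, i, j, hij, hxs, hsy⟩ := hR x y ⟨hxy, hmin⟩
      obtain ⟨k, hk, hks⟩ := ih (j + m) (by omega) hs (hsy.trans hyv)
      refine ⟨k + 1, ?_, s, hF r hr s hs (t + i) (by omega) (hrx.trans hxs), hks⟩
      have h₁ : (j + m) / t ≤ (t + m) / t := Nat.div_le_div_right (by omega)
      have h₂ : (t + (t + m)) / t = (t + m) / t + 1 := by
        rw [Nat.add_div_left _ ht]
      omega
    · push Not at hmin
      obtain ⟨j, hj, hxy'⟩ := hmin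
      obtain ⟨k, hk, hkv⟩ := ih (t + (j + m)) (by omega) hr (hrx.trans (hxy'.trans hyv))
      have : (t + (j + m)) / t ≤ (t + (t + m)) / t := Nat.div_le_div_right (by omega)
      exact ⟨k, by omega, hkv⟩

theorem HitsDistance.exists_reachLen (hR : HitsDistance E t R) (ht : 0 < t)
    (hEF : ∀ a b, E a b → F a b)
    (hF : ∀ a ∈ R, ∀ b ∈ R, ∀ k ≤ 2 * t, ReachLen E k a b → F a b)
    {ℓ : ℕ} {u v : V} (h : IsDistance E ℓ u v) :
    ∃ k ≤ ℓ / t + 3 * t, ReachLen F k u v := by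
  by_cases hℓ : ℓ < t
  · exact ⟨ℓ, by generalize ℓ / t = q; omega, h.1.mono hEF⟩
  obtain ⟨m, rfl⟩ : ∃ m, ℓ = t + m := ⟨ℓ - t, by omega⟩
  obtain ⟨y, huy, hyv⟩ := h.1.split
  obtain ⟨r, hr, i, j, hij, hur, hry⟩ :=
    hR u y ⟨huy, fun j hj hj' => h.2 (j + m) (by omega) (hj'.trans hyv)⟩
  obtain ⟨k, hk, hkv⟩ := hR.exists_reachLen_of_mem ht hEF hF (j + m) hr (hry.trans hyv)
  have : (j + m) / t ≤ (t + m) / t := Nat.div_le_div_right (by omega)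
  exact ⟨i + k, by omega, (hur.mono hEF).trans hkv⟩

end Shortcuts

/-- The combinatorial content of the paper's Theorem 4.2 (diameter reduction with
distance-limited searches): there is a constant `C > 0` such that every finite digraph
on `n ≥ 2` vertices admits at most `C·n·(log₂ n)⁴` shortcuts, each spanning a path of at
most `C·n^(2/3)·(log₂ n)^14` arcs in the original graph, whose addition reduces the
distance between every related pair to `C·n^(2/3)·(log₂ n)^(4/3)`. -/
theorem diameter_reduction_distance_limited_exists :
    ∃ C : ℝ, 0 < C ∧
      ∀ (V : Type) [Fintype V] [DecidableEq V] (E : V → V → Prop),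
        2 ≤ Fintype.card V →
        ∃ S : Finset (V × V),
          (∀ p ∈ S, ∃ k : ℕ,
            (k : ℝ) ≤ C * (Fintype.card V : ℝ) ^ ((2 : ℝ) / 3) *
              (Real.logb 2 (Fintype.card V)) ^ (14 : ℕ) ∧
            ReachLen E k p.1 p.2) ∧
          (S.card : ℝ) ≤
            C * (Fintype.card V : ℝ) * (Real.logb 2 (Fintype.card V)) ^ (4 : ℕ) ∧
          (∀ u v : V, Reaches E u v →
            ∃ k : ℕ,
              (k : ℝ) ≤ C * (Fintype.card V : ℝ) ^ ((2 : ℝ) / 3) *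
                (Real.logb 2 (Fintype.card V)) ^ ((4 : ℝ) / 3) ∧
              ReachLen (fun a b => E a b ∨ (a, b) ∈ S) k u v) := by
  classical
  refine ⟨64, by norm_num, ?_⟩
  intro V _ _ E hV
  set n := Fintype.card V with hn
  set t := Nat.sqrt n + 1 with ht
  have htn : n ≤ t * t := (Nat.lt_succ_sqrt n).le
  obtain ⟨R, hRcard, hR⟩ := exists_hitsDistance E t hV htn
  have hn2 : (2 : ℝ) ≤ n := by exact_mod_cast hV
  have hlog : 1 ≤ Real.logb 2 n := by
    rw [Real.le_logb_iff_rpow_le (by norm_num) (by linarith)]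
    simpa using hn2
  have htsq : (t : ℝ) ≤ 2 * √n := by
    have h₁ : ((Nat.sqrt n : ℕ) : ℝ) ≤ √n := Real.nat_sqrt_le_real_sqrt
    have h₂ : 1 ≤ √(n : ℝ) := Real.one_le_sqrt.mpr (by linarith)
    rw [ht]
    push_cast
    linarith
  have htpow : (t : ℝ) ≤ 2 * (n : ℝ) ^ ((2 : ℝ) / 3) := by
    refine htsq.trans ?_
    rw [Real.sqrt_eq_rpow]
    have := Real.rpow_le_rpow_of_exponent_le (x := n) (by linarith)
      (by norm_num : (1 : ℝ) / 2 ≤ 2 / 3)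
    linarith
  have hbound : ∀ k : ℕ, ∀ y : ℝ, 1 ≤ y → k ≤ 4 * t →
      (k : ℝ) ≤ 64 * (n : ℝ) ^ ((2 : ℝ) / 3) * y := by
    intro k y hy hk
    have hk' : (k : ℝ) ≤ 4 * t := by exact_mod_cast hk
    have hp : (0 : ℝ) ≤ (n : ℝ) ^ ((2 : ℝ) / 3) := by positivity
    nlinarith
  refine ⟨(R ×ˢ R).filter fun p => ∃ k ≤ 2 * t, ReachLen E k p.1 p.2, ?_, ?_, ?_⟩
  · intro p hp
    obtain ⟨k, hk, h⟩ := (Finset.mem_filter.mp hp).2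
    exact ⟨k, hbound k _ (one_le_pow₀ hlog) (by omega), h⟩
  · have hL : (⌈3 * Real.log n⌉₊ : ℝ) ≤ 4 * Real.logb 2 n := by
      have h₁ : Real.log n ≤ Real.logb 2 n := by
        rw [Real.logb, le_div_iff₀ (Real.log_pos (by norm_num))]
        have := Real.log_two_lt_d9
        have := Real.log_nonneg (x := n) (by linarith)
        nlinarith
      have h₂ := Nat.ceil_lt_add_one (a := 3 * Real.log n)
        (mul_nonneg (by norm_num) (Real.log_nonneg (by linarith)))
      linarith
    have hRcard' : (R.card : ℝ) ≤ 2 * √n * (4 * Real.logb 2 n) := by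
      calc (R.card : ℝ) ≤ t * (⌈3 * Real.log n⌉₊ : ℝ) := by exact_mod_cast hRcard
        _ ≤ 2 * √n * (4 * Real.logb 2 n) := by gcongr
    calc (((R ×ˢ R).filter fun p => ∃ k ≤ 2 * t, ReachLen E k p.1 p.2).card : ℝ)
        ≤ (R.card : ℝ) ^ 2 := by
          have h := Finset.card_filter_le (R ×ˢ R)
            fun p => ∃ k ≤ 2 * t, ReachLen E k p.1 p.2
          rw [Finset.card_product, ← sq] at h
          exact_mod_cast h
      _ ≤ (2 * √n * (4 * Real.logb 2 n)) ^ 2 := by gcongr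
      _ = 64 * n * Real.logb 2 n ^ 2 := by
          have := Real.sq_sqrt (Nat.cast_nonneg (α := ℝ) n)
          linear_combination 64 * Real.logb 2 n ^ 2 * this
      _ ≤ 64 * n * Real.logb 2 n ^ 4 := by
          have := pow_le_pow_right₀ hlog (by norm_num : 2 ≤ 4)
          gcongr
  · intro u v huv
    obtain ⟨ℓ, hℓ⟩ := huv.exists_isDistance
    obtain ⟨k, hk, h⟩ := hR.exists_reachLen
      (F := fun a b => E a b ∨
        (a, b) ∈ (R ×ˢ R).filter fun p => ∃ k ≤ 2 * t, ReachLen E k p.1 p.2)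
      (Nat.succ_pos _) (fun _ _ => Or.inl)
      (fun a ha b hb k hk h => Or.inr (Finset.mem_filter.mpr
        ⟨Finset.mk_mem_product ha hb, k, hk, h⟩)) hℓ
    have hℓn : ℓ < n := hℓ.lt_card_pathInterval.trans_le (Finset.card_le_univ _)
    have hdiv : ℓ / t ≤ t := Nat.div_le_of_le_mul (by omega)
    exact ⟨k, hbound k _ (Real.one_le_rpow hlog (by norm_num)) (by omega), h⟩
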